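/- Let p, q be distributions on a nonempty finite set X. For 0 < c_L < 1 < c_U define H²_TV(c_L, c_U) = ∑_{x∈X} φ_x(c_L, c_U), where φ_x(c_L, c_U) = ((√c_L − 1)²/(1 + c_L))·(p(x) + q(x)) if p(x) < c_L·q(x); φ_x(c_L, c_U) = (√(p(x)) − √(q(x)))² if c_L·q(x) ≤ p(x) ≤ c_U·q(x); and φ_x(c_L, c_U) = ((√c_U − 1)²/(1 + c_U))·(p(x) + q(x)) if p(x) > c_U·q(x). Then for all 0 < c_L' ≤ c_L < 1 < c_U ≤ c_U': H²_TV(c_L', c_U') ≥ H²_TV(c_L, c_U). In other words, H²_TV is nondecreasing in the upper clip c_U and nonincreasing in the lower clip c_L. -/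

import Mathlib

open scoped Classical
open Finset

noncomputable section

/-- A probability distribution on a finite set. -/
def IsDist {X : Type*} [Fintype X] (p : X → ℝ) : Prop :=
  (∀ x, 0 ≤ p x) ∧ ∑ x, p x = 1

/-- The per-point contribution to the squared Hellinger divergence between the TV
least-favourable-distribution formulas at clips `(cL, cU)`. -/
def phiTV {X : Type*} [Fintype X] (p q : X → ℝ) (cL cU : ℝ) (x : X) : ℝ :=
  if p x < cL * q x then ((Real.sqrt cL - 1) ^ 2 / (1 + cL)) * (p x + q x)
  else if p x > cU * q x then ((Real.sqrt cU - 1) ^ 2 / (1 + cU)) * (p x + q x)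
  else (Real.sqrt (p x) - Real.sqrt (q x)) ^ 2

/-- Clipping the likelihood ratio at `c` decreases the Hellinger contribution as soon as `p / q`
lies outside the interval between `c` and `c⁻¹`. -/
lemma clipped_le_sq_sqrt_sub {c p q : ℝ} (hc : 0 < c) (hp : 0 ≤ p) (hq : 0 ≤ q)
    (h : 0 ≤ (√c * √p - √q) * (√p - √c * √q)) :
    (√c - 1) ^ 2 / (1 + c) * (p + q) ≤ (√p - √q) ^ 2 := by
  rw [div_mul_eq_mul_div, div_le_iff₀ (by linarith)]
  have hc' := Real.sq_sqrt hc.le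
  have hp' := Real.sq_sqrt hp
  have hq' := Real.sq_sqrt hq
  generalize √c = a at *
  generalize √p = s at *
  generalize √q = t at *
  subst hc' hp' hq'
  linear_combination 2 * h

lemma clipped_le_of_le_mul {c p q : ℝ} (hc : 0 < c) (hc1 : c ≤ 1) (hp : 0 ≤ p) (hq : 0 ≤ q)
    (h : p ≤ c * q) :
    (√c - 1) ^ 2 / (1 + c) * (p + q) ≤ (√p - √q) ^ 2 := by
  refine clipped_le_sq_sqrt_sub hc hp hq (mul_nonneg_of_nonpos_of_nonpos ?_ ?_)
  · rw [← Real.sqrt_mul hc.le, sub_nonpos]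
    exact Real.sqrt_le_sqrt (by nlinarith)
  · rw [← Real.sqrt_mul hc.le, sub_nonpos]
    exact Real.sqrt_le_sqrt h

lemma clipped_le_of_mul_le {c p q : ℝ} (hc1 : 1 ≤ c) (hp : 0 ≤ p) (hq : 0 ≤ q)
    (h : c * q ≤ p) :
    (√c - 1) ^ 2 / (1 + c) * (p + q) ≤ (√p - √q) ^ 2 := by
  have hc : 0 < c := by linarith
  refine clipped_le_sq_sqrt_sub hc hp hq (mul_nonneg ?_ ?_)
  · rw [← Real.sqrt_mul hc.le, sub_nonneg]
    exact Real.sqrt_le_sqrt (by nlinarith)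
  · rw [← Real.sqrt_mul hc.le, sub_nonneg]
    exact Real.sqrt_le_sqrt h

lemma clip_coeff_anti {c' c : ℝ} (h0 : 0 < c') (h1 : c' ≤ c) (h2 : c ≤ 1) :
    (√c - 1) ^ 2 / (1 + c) ≤ (√c' - 1) ^ 2 / (1 + c') := by
  have h := clipped_le_of_le_mul (h0.trans_le h1) h2 h0.le zero_le_one (by linarith)
  rwa [Real.sqrt_one, add_comm c' 1, ← le_div_iff₀ (by linarith)] at h

lemma clip_coeff_mono {c c' : ℝ} (h1 : 1 ≤ c) (h2 : c ≤ c') :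
    (√c - 1) ^ 2 / (1 + c) ≤ (√c' - 1) ^ 2 / (1 + c') := by
  have h := clipped_le_of_mul_le (p := c') h1 (by linarith) zero_le_one (by linarith)
  rwa [Real.sqrt_one, add_comm c' 1, ← le_div_iff₀ (by linarith)] at h

/-- The squared Hellinger divergence between the TV LFD formulas, as a function of the
clips: pushing the upper clip up and/or the lower clip down can only increase it. -/
theorem tv_hellinger_monotone_in_clips
    {X : Type*} [Fintype X] [Nonempty X]
    (p q : X → ℝ) (hp : IsDist p) (hq : IsDist q)
    (cL' cL cU cU' : ℝ)
    (h0 : 0 < cL') (h1 : cL' ≤ cL) (h2 : cL < 1) (h3 : 1 < cU) (h4 : cU ≤ cU') :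
    ∑ x, phiTV p q cL cU x ≤ ∑ x, phiTV p q cL' cU' x := by
  refine sum_le_sum fun x _ => ?_
  have hpx := hp.1 x
  have hqx := hq.1 x
  have hL : cL' * q x ≤ cL * q x := mul_le_mul_of_nonneg_right h1 hqx
  have hU : cU * q x ≤ cU' * q x := mul_le_mul_of_nonneg_right h4 hqx
  have hLU : cL * q x ≤ cU * q x := mul_le_mul_of_nonneg_right (by linarith) hqx
  unfold phiTV
  split_ifs
  any_goals linarith
  · exact mul_le_mul_of_nonneg_right (clip_coeff_anti h0 h1 h2.le) (by linarith)
  · exact clipped_le_of_le_mul (h0.trans_le h1) h2.le hpx hqx (by linarith)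
  · exact mul_le_mul_of_nonneg_right (clip_coeff_mono h3.le h4) (by linarith)
  · exact clipped_le_of_mul_le h3.le hpx hqx (by linarith)

end
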